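/- Set L̂ = MD. For every k ≥ 1 the following identity holds in Mat_{N^{k+1}}(A): D_{⟨k→1⟩} · L̂_{⟨k+1⟩} = L̂_{⟨k+1⟩} · D_{⟨k→1⟩} · J_{k+1}⁻¹ + D_{⟨k→1⟩} · (I − J_{k+1}⁻¹)/(q − q⁻¹), where D_{⟨k→1⟩} = D_{⟨k⟩}D_{⟨k−1⟩}⋯D_{⟨1⟩}. -/

import Mathlib

open scoped BigOperators

noncomputable section

/-- One-site embedding of an `N×N` matrix into `Mat_{N^k}` at 0-based position `i`
(the paper's `X_{i+1}` in 1-based numbering).  Out of range we return the identity. -/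
def matAt {α : Type*} [Semiring α] (N k : ℕ) (X : Matrix (Fin N) (Fin N) α) (i : ℕ) :
    Matrix (Fin k → Fin N) (Fin k → Fin N) α :=
  if h : i < k then
    Matrix.of fun a b =>
      if ∀ l : Fin k, (l : ℕ) ≠ i → a l = b l then X (a ⟨i, h⟩) (b ⟨i, h⟩) else 0
  else 1

/-- Two-site embedding of an operator on `V⊗V` into `Mat_{N^k}` at 0-based positions
`i, i+1` (the paper's `R_{i+1}` in 1-based numbering). -/
def opAt {α : Type*} [Semiring α] (N k : ℕ)
    (R : Matrix (Fin N × Fin N) (Fin N × Fin N) α) (i : ℕ) :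
    Matrix (Fin k → Fin N) (Fin k → Fin N) α :=
  if h : i + 1 < k then
    Matrix.of fun a b =>
      if ∀ l : Fin k, (l : ℕ) ≠ i → (l : ℕ) ≠ i + 1 → a l = b l then
        R (a ⟨i, by omega⟩, a ⟨i + 1, h⟩) (b ⟨i, by omega⟩, b ⟨i + 1, h⟩)
      else 0
  else 1

/-- A numeric (complex) matrix viewed inside `Mat(A)` via the unit of `A`. -/
def toA (A : Type*) [Semiring A] [Algebra ℂ A] {ι : Type*} (X : Matrix ι ι ℂ) :
    Matrix ι ι A :=
  X.map (algebraMap ℂ A)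

/-- The braid relation `R₁R₂R₁ = R₂R₁R₂` on `V^{⊗3}`. -/
def IsBraid (N : ℕ) (R : Matrix (Fin N × Fin N) (Fin N × Fin N) ℂ) : Prop :=
  opAt N 3 R 0 * opAt N 3 R 1 * opAt N 3 R 0 = opAt N 3 R 1 * opAt N 3 R 0 * opAt N 3 R 1

/-- The Hecke condition `(q·I − R)(q⁻¹·I + R) = 0`. -/
def IsHecke (N : ℕ) (q : ℂ) (R : Matrix (Fin N × Fin N) (Fin N × Fin N) ℂ) : Prop :=
  (q • (1 : Matrix (Fin N × Fin N) (Fin N × Fin N) ℂ) - R) * (q⁻¹ • 1 + R) = 0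

/-- `q` is generic: `q ∉ {0, 1, −1}` and `qⁿ ≠ 1` for all positive integers `n`. -/
def GenericQ (q : ℂ) : Prop :=
  q ≠ 0 ∧ q ≠ 1 ∧ q ≠ -1 ∧ ∀ n : ℕ, 0 < n → q ^ n ≠ 1

/-- The reflection-equation type relation `R X₁ R X₁ = X₁ R X₁ R` in `Mat_{N²}`. -/
def RErel {α : Type*} [Semiring α] (N : ℕ)
    (R : Matrix (Fin N × Fin N) (Fin N × Fin N) α) (X : Matrix (Fin N) (Fin N) α) : Prop :=
  opAt N 2 R 0 * matAt N 2 X 0 * opAt N 2 R 0 * matAt N 2 X 0 =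
    matAt N 2 X 0 * opAt N 2 R 0 * matAt N 2 X 0 * opAt N 2 R 0

/-- The quantum-double permutation relation `D₁ R M₁ R = R M₁ R⁻¹ D₁ + R` in `Mat_{N²}(A)`. -/
def PermRel {A : Type*} [Ring A] [Algebra ℂ A] (N : ℕ)
    (R Rinv : Matrix (Fin N × Fin N) (Fin N × Fin N) ℂ)
    (M D : Matrix (Fin N) (Fin N) A) : Prop :=
  matAt N 2 D 0 * opAt N 2 (toA A R) 0 * matAt N 2 M 0 * opAt N 2 (toA A R) 0 =
    opAt N 2 (toA A R) 0 * matAt N 2 M 0 * opAt N 2 (toA A Rinv) 0 * matAt N 2 D 0 +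
      opAt N 2 (toA A R) 0

/-- The homogeneous permutation relation `D₁ R M₁ R = R M₁ R⁻¹ D₁` in `Mat_{N²}(A)`. -/
def PermRelHom {A : Type*} [Ring A] [Algebra ℂ A] (N : ℕ)
    (R Rinv : Matrix (Fin N × Fin N) (Fin N × Fin N) ℂ)
    (M D : Matrix (Fin N) (Fin N) A) : Prop :=
  matAt N 2 D 0 * opAt N 2 (toA A R) 0 * matAt N 2 M 0 * opAt N 2 (toA A R) 0 =
    opAt N 2 (toA A R) 0 * matAt N 2 M 0 * opAt N 2 (toA A Rinv) 0 * matAt N 2 D 0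

/-- Overline copies: `ovCopy … r = X_{⟨r+1⟩}`, i.e. `X_{⟨1⟩} = X⊗I⊗⋯⊗I` and
`X_{⟨r+1⟩} = R_r X_{⟨r⟩} R_r⁻¹`. -/
def ovCopy {α : Type*} [Semiring α] (N k : ℕ)
    (R Rinv : Matrix (Fin N × Fin N) (Fin N × Fin N) α)
    (X : Matrix (Fin N) (Fin N) α) : ℕ → Matrix (Fin k → Fin N) (Fin k → Fin N) α
  | 0 => matAt N k X 0
  | r + 1 => opAt N k R r * ovCopy N k R Rinv X r * opAt N k Rinv r

/-- Underline copies: `unCopy … r = X_{[r+1]}`, i.e. `X_{[1]} = X⊗I⊗⋯⊗I` and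
`X_{[r+1]} = R_r⁻¹ X_{[r]} R_r`. -/
def unCopy {α : Type*} [Semiring α] (N k : ℕ)
    (R Rinv : Matrix (Fin N × Fin N) (Fin N × Fin N) α)
    (X : Matrix (Fin N) (Fin N) α) : ℕ → Matrix (Fin k → Fin N) (Fin k → Fin N) α
  | 0 => matAt N k X 0
  | r + 1 => opAt N k Rinv r * unCopy N k R Rinv X r * opAt N k R r

/-- `X_{⟨1→n⟩} = X_{⟨1⟩}X_{⟨2⟩}⋯X_{⟨n⟩}`. -/
def ovProd {α : Type*} [Semiring α] (N k : ℕ)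
    (R Rinv : Matrix (Fin N × Fin N) (Fin N × Fin N) α)
    (X : Matrix (Fin N) (Fin N) α) (n : ℕ) : Matrix (Fin k → Fin N) (Fin k → Fin N) α :=
  ((List.range n).map (ovCopy N k R Rinv X)).prod

/-- `X_{⟨n→1⟩} = X_{⟨n⟩}X_{⟨n−1⟩}⋯X_{⟨1⟩}`. -/
def ovProdRev {α : Type*} [Semiring α] (N k : ℕ)
    (R Rinv : Matrix (Fin N × Fin N) (Fin N × Fin N) α)
    (X : Matrix (Fin N) (Fin N) α) (n : ℕ) : Matrix (Fin k → Fin N) (Fin k → Fin N) α :=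
  ((List.range n).reverse.map (ovCopy N k R Rinv X)).prod

/-- Shifted Jucys–Murphy matrices: `JMup … R n s = J_{s+1}^{↑n}`, i.e. `J₁^{↑n} = I` and
`J_{s+1}^{↑n} = R_{n+s} J_s^{↑n} R_{n+s}` (paper's 1-based `R_{n+s}` is `opAt … (n+s-1)`).
Applying it to `R⁻¹` produces `(J_{s+1}^{↑n})⁻¹`. -/
def JMup {α : Type*} [Semiring α] (N k : ℕ)
    (R : Matrix (Fin N × Fin N) (Fin N × Fin N) α) (n : ℕ) :
    ℕ → Matrix (Fin k → Fin N) (Fin k → Fin N) α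
  | 0 => 1
  | s + 1 => opAt N k R (n + s) * JMup N k R n s * opAt N k R (n + s)

/-- The quantum trace `Tr_{R(1…n)}(X) = Tr(C₁C₂⋯C_n X)`. -/
def qTr {α : Type*} [Semiring α] (N n : ℕ) (C : Matrix (Fin N) (Fin N) α)
    (X : Matrix (Fin n → Fin N) (Fin n → Fin N) α) : α :=
  Matrix.trace (((List.range n).map (matAt N n C)).prod * X)

/-- The matrix `C`, `C_i^j = Σ_k Ψ_{ik}^{jk}`. -/
def traceMat (N : ℕ) (Ψ : Matrix (Fin N × Fin N) (Fin N × Fin N) ℂ) :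
    Matrix (Fin N) (Fin N) ℂ :=
  Matrix.of fun i j => ∑ k, Ψ (i, k) (j, k)

/-- Skew-invertibility of `R`: `Tr₂(R₁₂Ψ₂₃) = Tr₂(Ψ₁₂R₂₃) = P₁₃`, written componentwise. -/
def SkewInv (N : ℕ) (R Ψ : Matrix (Fin N × Fin N) (Fin N × Fin N) ℂ) : Prop :=
  (∀ i k l n : Fin N, ∑ j, ∑ b, R (i, j) (l, b) * Ψ (b, k) (j, n) =
      if i = n ∧ k = l then 1 else 0) ∧
  (∀ i k l n : Fin N, ∑ j, ∑ b, Ψ (i, j) (l, b) * R (b, k) (j, n) =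
      if i = n ∧ k = l then 1 else 0)

/-- The generators `R₁, …, R_{n−1}` (1-based) of the Hecke-algebra image inside
`End(V^{⊗k})`, as a subset of `Mat_{N^k}`. -/
def genSet {α : Type*} [Semiring α] (N k n : ℕ)
    (R : Matrix (Fin N × Fin N) (Fin N × Fin N) α) :
    Set (Matrix (Fin k → Fin N) (Fin k → Fin N) α) :=
  {X | ∃ i : ℕ, i + 1 < n ∧ X = opAt N k R i}

/-- The left ideal of `A` generated by the entries of `D`. -/
def entryIdeal (A : Type*) [Ring A] {N : ℕ} (D : Matrix (Fin N) (Fin N) A) :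
    Submodule A A :=
  Submodule.span A {x : A | ∃ i j : Fin N, x = D i j}

/-- The normally ordered monomial `:L̂_{⟨1→k⟩}: = M_{⟨1→k⟩} D_{⟨k→1⟩} ∏_{s=1}^{k} J_s⁻¹`. -/
def normOrd {α : Type*} [Semiring α] (N k : ℕ)
    (R Rinv : Matrix (Fin N × Fin N) (Fin N × Fin N) α)
    (M D : Matrix (Fin N) (Fin N) α) (n : ℕ) :
    Matrix (Fin k → Fin N) (Fin k → Fin N) α :=
  ovProd N k R Rinv M n * ovProdRev N k R Rinv D n *
    ((List.range n).map (fun s => JMup N k Rinv 0 s)).prod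

/-! ### Conjugated copies in an abstract ring -/

/-- If `X 0` commutes with all `r j`, `1 ≤ j`, then its `i`-th conjugated copy commutes with all
`r j`, `i + 1 ≤ j`. -/
lemma commute_conjCopy {B : Type*} [Ring B] {r s X : ℕ → B} (hrs : ∀ i, r i * s i = 1)
    (hsr : ∀ i, s i * r i = 1) (hfar : ∀ i j, i + 2 ≤ j → Commute (r i) (r j))
    (hX : ∀ i, X (i + 1) = r i * X i * s i) (hX0 : ∀ j, 1 ≤ j → Commute (X 0) (r j)) :
    ∀ i j, i + 1 ≤ j → Commute (X i) (r j) := by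
  intro i
  induction i with
  | zero => exact fun j hj => hX0 j hj
  | succ i ih =>
    intro j hj
    have hr := hfar i j hj
    have hs : Commute (s i) (r j) := by
      have : Commute (↑(⟨r i, s i, hrs i, hsr i⟩ : Bˣ)⁻¹ : B) (r j) :=
        Commute.units_inv_left hr
      exact this
    rw [hX]
    exact (hr.mul_left (ih j (by omega))).mul_left hs

/-- The permutation relation between neighbouring conjugated copies. -/
lemma conjCopy_perm {B : Type*} [Ring B] {n : ℕ} {r s D L : ℕ → B}
    (hrs : ∀ i, r i * s i = 1) (hsr : ∀ i, s i * r i = 1)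
    (hbraid : ∀ i, i + 2 < n → r i * r (i + 1) * r i = r (i + 1) * r i * r (i + 1))
    (hDs : ∀ i, D (i + 1) = r i * D i * s i) (hLs : ∀ i, L (i + 1) = r i * L i * s i)
    (hDr : ∀ i, Commute (D i) (r (i + 1))) (hLr : ∀ i, Commute (L i) (r (i + 1)))
    (h0 : D 0 * r 0 * L 0 = r 0 * L 0 * s 0 * D 0 * s 0 + D 0) :
    ∀ k, k + 1 < n → D k * r k * L k = L (k + 1) * D k * s k + D k := by
  intro k
  induction k with
  | zero => intro _; rw [h0, hLs]
  | succ k ih =>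
    intro hk
    have ih := ih (by omega)
    have hb := hbraid k (by omega)
    have hD := (hDr k).eq
    have hL := (hLr k).eq
    have h1 := hrs k
    have h2 := hsr k
    have h3 := hrs (k + 1)
    have h4 := hsr (k + 1)
    rw [hLs (k + 1), hDs k, hLs k]
    rw [hLs k] at ih
    generalize r (k + 1) = y at *
    generalize s (k + 1) = y' at *
    generalize r k = x at *
    generalize s k = x' at *
    generalize D k = d at *
    generalize L k = l at *
    have hy'D : d * y' = y' * d := by
      calc d * y' = y' * y * d * y' := by rw [h4, one_mul]
        _ = y' * (d * y) * y' := by rw [hD]; noncomm_ring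
        _ = y' * d * (y * y') := by noncomm_ring
        _ = y' * d := by rw [h3, mul_one]
    have hy'L : l * y' = y' * l := by
      calc l * y' = y' * y * l * y' := by rw [h4, one_mul]
        _ = y' * (l * y) * y' := by rw [hL]; noncomm_ring
        _ = y' * l * (y * y') := by noncomm_ring
        _ = y' * l := by rw [h3, mul_one]
    have cx : ∀ z, x * (x' * z) = z := fun z => by rw [← mul_assoc, h1, one_mul]
    have cx' : ∀ z, x' * (x * z) = z := fun z => by rw [← mul_assoc, h2, one_mul]
    have cy : ∀ z, y * (y' * z) = z := fun z => by rw [← mul_assoc, h3, one_mul]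
    have cy' : ∀ z, y' * (y * z) = z := fun z => by rw [← mul_assoc, h4, one_mul]
    have hb₁ : x' * y * x = y * x * y' := by
      calc x' * y * x = x' * (y * x * y) * y' := by
            simp only [mul_assoc, h3, mul_one]
        _ = y * x * y' := by rw [← hb]; simp only [mul_assoc, cx']
    have hb₂ : y * x' * y' = x' * y' * x := by
      calc y * x' * y' = x' * y' * (y * x * y) * x' * y' := by simp only [mul_assoc, cx', cy']
        _ = x' * y' * x := by rw [← hb]; simp only [mul_assoc, cx, h3, mul_one]
    have hb₃ : x' * y' * x' = y' * x' * y' := by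
      calc x' * y' * x' = x' * y' * x' * (y * x * y) * y' * x' * y' := by
            simp only [mul_assoc, cx, h3, mul_one]
        _ = y' * x' * y' := by rw [← hb]; simp only [mul_assoc, cx', cy']
    calc x * d * x' * y * (x * l * x') = x * d * (x' * y * x) * l * x' := by noncomm_ring
      _ = x * (d * y) * x * (y' * l) * x' := by rw [hb₁]; noncomm_ring
      _ = x * y * (d * x * l) * y' * x' := by rw [hD, ← hy'L]; noncomm_ring
      _ = (x * y * x) * l * x' * d * (x' * y' * x') + x * y * (d * y') * x' := by
          rw [ih]; noncomm_ring
      _ = y * x * (y * l) * x' * (d * y') * x' * y' + x * d * x' := by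
          rw [hb, hb₃, show x * y * (d * y') * x' = x * d * x' by
            rw [hy'D]; simp only [mul_assoc, cy]]
          noncomm_ring
      _ = y * x * l * (y * x' * y') * d * x' * y' + x * d * x' := by
          rw [← hL, hy'D]; noncomm_ring
      _ = _ := by rw [hb₂]; noncomm_ring

/-- Moving an ordered product of copies of `D` through a copy of `L`. -/
lemma conjCopy_prod_perm {K B : Type*} [Field K] [Ring B] [Algebra K B] {n : ℕ} {c : K}
    (hc : c ≠ 0) {r s D L P J : ℕ → B}
    (hrs : ∀ i, r i * s i = 1) (hhecke : ∀ i, i + 1 < n → r i - s i = c • 1)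
    (hLs : ∀ i, L (i + 1) = r i * L i * s i)
    (hP0 : P 0 = 1) (hPs : ∀ i, P (i + 1) = D i * P i)
    (hJ0 : J 0 = 1) (hJs : ∀ i, J (i + 1) = s i * J i * s i)
    (hPr : ∀ i, Commute (P i) (r i)) (hPs' : ∀ i, Commute (P i) (s i))
    (hperm : ∀ k, k + 1 < n → D k * r k * L k = L (k + 1) * D k * s k + D k) :
    ∀ k, k < n → P k * L k = L k * P k * J k + P k * (c⁻¹ • (1 - J k)) := by
  intro k
  induction k with
  | zero => intro _; simp [hP0, hJ0]
  | succ k ih =>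
    intro hk
    have ih := ih (by omega)
    have hr : r k = s k + c • 1 := by rw [← hhecke k hk]; abel
    have hJ : r k * J k * s k = J (k + 1) + c • (J k * s k) := by
      rw [hr, hJs]; simp [add_mul]
    calc P (k + 1) * L (k + 1) = D k * (P k * r k) * L k * s k := by
          rw [hPs, hLs]; noncomm_ring
      _ = D k * r k * (P k * L k) * s k := by rw [(hPr k).eq]; noncomm_ring
      _ = (D k * r k * L k) * P k * J k * s k +
            D k * (r k * P k) * (c⁻¹ • (1 - J k)) * s k := by rw [ih]; noncomm_ring
      _ = L (k + 1) * D k * (s k * P k) * J k * s k + D k * P k * J k * s k +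
            D k * P k * (c⁻¹ • (r k * s k - r k * J k * s k)) := by
          rw [hperm k hk, ← (hPr k).eq]
          simp only [mul_smul_comm, smul_mul_assoc]
          noncomm_ring
      _ = _ := by
          rw [hrs, hJ, ← (hPs' k).eq, hPs, hJs, smul_sub, smul_sub, smul_add, smul_smul,
            inv_mul_cancel₀ hc, one_smul]
          noncomm_ring

/-! ### Embeddings of tensor factors -/

/-- The operator acting as `X` on the tensor factors selected by `f` and trivially elsewhere. -/
def siteEmbed {α : Type*} [Semiring α] {σ τ ν : Type*}
    (f : σ → τ) (X : Matrix (σ → ν) (σ → ν) α) : Matrix (τ → ν) (τ → ν) α :=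
  open Classical in
  Matrix.of fun a b => if ∀ l, l ∉ Set.range f → a l = b l then X (a ∘ f) (b ∘ f) else 0

section siteEmbed

variable {α : Type*} [Semiring α] {σ τ ρ ν : Type*}

lemma siteEmbed_apply (f : σ → τ) (X : Matrix (σ → ν) (σ → ν) α) (a b : τ → ν)
    [Decidable (∀ l, l ∉ Set.range f → a l = b l)] :
    siteEmbed f X a b =
      if ∀ l, l ∉ Set.range f → a l = b l then X (a ∘ f) (b ∘ f) else 0 := by
  by_cases h : ∀ l, l ∉ Set.range f → a l = b l
  · rw [if_pos h]
    exact if_pos h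
  · rw [if_neg h]
    exact if_neg h

lemma siteEmbed_add (f : σ → τ) (X Y : Matrix (σ → ν) (σ → ν) α) :
    siteEmbed f (X + Y) = siteEmbed f X + siteEmbed f Y := by
  classical
  ext a b
  simp only [siteEmbed_apply, Matrix.add_apply]
  split_ifs <;> simp

lemma siteEmbed_smul {K : Type*} [CommSemiring K] [Algebra K α] (f : σ → τ) (c : K)
    (X : Matrix (σ → ν) (σ → ν) α) : siteEmbed f (c • X) = c • siteEmbed f X := by
  classical
  ext a b
  simp only [siteEmbed_apply, Matrix.smul_apply]
  split_ifs <;> simp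

lemma siteEmbed_siteEmbed {f : σ → τ} (hf : Function.Injective f) (g : ρ → σ)
    (X : Matrix (ρ → ν) (ρ → ν) α) : siteEmbed f (siteEmbed g X) = siteEmbed (f ∘ g) X := by
  classical
  ext a b
  simp only [siteEmbed_apply, ← ite_and]
  refine if_congr ⟨fun ⟨h₁, h₂⟩ l hl => ?_, fun h => ⟨fun l hl => h l ?_, fun l hl => h _ ?_⟩⟩
    rfl rfl
  · by_cases hlf : l ∈ Set.range f
    · obtain ⟨i, rfl⟩ := hlf
      exact h₂ i fun ⟨j, hj⟩ => hl ⟨j, by simp [hj]⟩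
    · exact h₁ l hlf
  · rintro ⟨i, rfl⟩
    exact hl ⟨g i, rfl⟩
  · rintro ⟨i, hi⟩
    exact hl ⟨i, hf hi⟩

lemma siteEmbed_one [Fintype σ] [Fintype τ] [DecidableEq ν] (f : σ → τ) :
    siteEmbed f (1 : Matrix (σ → ν) (σ → ν) α) = 1 := by
  classical
  ext a b
  rw [siteEmbed_apply, Matrix.one_apply, Matrix.one_apply]
  by_cases h : a = b
  · simp [h]
  · rw [if_neg h]
    split_ifs with h₁ h₂
    · refine absurd (funext fun l => ?_) h
      by_cases hl : l ∈ Set.range f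
      · obtain ⟨i, rfl⟩ := hl
        exact congrFun h₂ i
      · exact h₁ l hl
    all_goals rfl

variable [Fintype τ] [Fintype ν] [DecidableEq τ]

lemma siteEmbed_mul [Fintype σ] [DecidableEq σ] {f : σ → τ} (hf : Function.Injective f)
    (X Y : Matrix (σ → ν) (σ → ν) α) :
    siteEmbed f (X * Y) = siteEmbed f X * siteEmbed f Y := by
  classical
  ext a b
  rw [siteEmbed_apply, Matrix.mul_apply, Matrix.mul_apply]
  split_ifs with hab
  · refine Finset.sum_of_injOn (fun e => Function.extend f e a) ?_ (by simp) ?_ ?_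
    · intro e _ e' _ h
      have := congrArg (· ∘ f) h
      simpa [Function.extend_comp hf] using this
    · intro c _ hc
      rw [siteEmbed_apply, if_neg, zero_mul]
      intro hac
      refine hc ⟨c ∘ f, by simp, funext fun l => ?_⟩
      by_cases hl : l ∈ Set.range f
      · obtain ⟨i, rfl⟩ := hl
        simp [hf.extend_apply]
      · beta_reduce
        rw [Function.extend_apply' _ _ _ (by simpa using hl), hac l hl]
    · intro e _
      have hl : ∀ l, l ∉ Set.range f → Function.extend f e a l = a l := fun l hl =>
        Function.extend_apply' _ _ _ (by simpa using hl)
      rw [siteEmbed_apply, siteEmbed_apply, if_pos fun l h => (hl l h).symm,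
        if_pos fun l h => (hl l h).trans (hab l h), Function.extend_comp hf]
  · refine (Finset.sum_eq_zero fun c _ => ?_).symm
    rw [siteEmbed_apply, siteEmbed_apply]
    split_ifs with h₁ h₂
    · exact absurd (fun l hl => (h₁ l hl).trans (h₂ l hl)) hab
    all_goals simp

lemma siteEmbed_mul_apply_of_disjoint {f : σ → τ} {g : ρ → τ}
    (hfg : ∀ i j, f i ≠ g j) (X : Matrix (σ → ν) (σ → ν) α) (Y : Matrix (ρ → ν) (ρ → ν) α)
    (a b : τ → ν) :
    (siteEmbed f X * siteEmbed g Y) a b =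
      open Classical in if ∀ l, l ∉ Set.range f → l ∉ Set.range g → a l = b l then
        X (a ∘ f) (b ∘ f) * Y (a ∘ g) (b ∘ g) else 0 := by
  classical
  rw [Matrix.mul_apply]
  have hc : ∀ c : τ → ν, c ≠ (fun l => if l ∈ Set.range f then b l else a l) →
      siteEmbed f X a c * siteEmbed g Y c b = 0 := by
    intro c hc
    rw [siteEmbed_apply, siteEmbed_apply]
    split_ifs with h₁ h₂
    · refine absurd (funext fun l => ?_) hc
      split_ifs with hl
      · obtain ⟨i, rfl⟩ := hl
        exact h₂ _ fun ⟨j, hj⟩ => hfg i j hj.symm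
      · exact (h₁ l hl).symm
    all_goals simp
  rw [Finset.sum_eq_single _ (fun c _ h => hc c h) (by simp), siteEmbed_apply, siteEmbed_apply,
    if_pos fun l hl => (if_neg hl).symm]
  have hbf : (fun l => if l ∈ Set.range f then b l else a l) ∘ f = b ∘ f := by
    ext i; simp
  have hag : (fun l => if l ∈ Set.range f then b l else a l) ∘ g = a ∘ g := by
    ext j; simp [hfg]
  rw [hbf, hag, mul_ite, mul_zero]
  refine if_congr ⟨fun h l hf hg => ?_, fun h l hg => ?_⟩ rfl rfl
  · simpa only [if_neg hf] using h l hg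
  · split_ifs with hl
    · rfl
    · exact h l hl hg

lemma siteEmbed_commute {f : σ → τ} {g : ρ → τ} (hfg : ∀ i j, f i ≠ g j)
    (X : Matrix (σ → ν) (σ → ν) α) (Y : Matrix (ρ → ν) (ρ → ν) α)
    (hXY : ∀ a b c d, Commute (X a b) (Y c d)) : Commute (siteEmbed f X) (siteEmbed g Y) := by
  classical
  ext a b
  rw [siteEmbed_mul_apply_of_disjoint hfg,
    siteEmbed_mul_apply_of_disjoint fun i j => (hfg j i).symm]
  exact if_congr ⟨fun h l h₁ h₂ => h l h₂ h₁, fun h l h₁ h₂ => h l h₂ h₁⟩ (hXY _ _ _ _).eq rfl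

end siteEmbed

/-! ### One- and two-site operators as embeddings -/

section sites

variable {α : Type*} [Semiring α] {N n m : ℕ}

lemma matAt_eq_siteEmbed (X : Matrix (Fin N) (Fin N) α) {i : ℕ} (h : i < n) :
    matAt N n X i = siteEmbed (fun _ : Unit => (⟨i, h⟩ : Fin n))
      (X.submatrix (Equiv.funUnique Unit (Fin N)) (Equiv.funUnique Unit (Fin N))) := by
  classical
  ext a b
  rw [siteEmbed_apply, matAt, dif_pos h]
  simp only [Matrix.of_apply]
  refine if_congr ⟨fun h l hl => h l fun e => hl ⟨(), Fin.ext e.symm⟩, fun h l hl => h l ?_⟩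
    rfl rfl
  rintro ⟨_, rfl⟩
  exact hl rfl

lemma opAt_eq_siteEmbed (R : Matrix (Fin N × Fin N) (Fin N × Fin N) α) {i : ℕ}
    (h : i + 1 < n) :
    opAt N n R i = siteEmbed (fun j : Fin 2 => (⟨i + j, by omega⟩ : Fin n))
      (R.submatrix (finTwoArrowEquiv (Fin N)) (finTwoArrowEquiv (Fin N))) := by
  classical
  ext a b
  rw [siteEmbed_apply, opAt, dif_pos h]
  simp only [Matrix.of_apply]
  refine if_congr ⟨fun h l hl => h l (fun e => hl ⟨0, Fin.ext (by simp [e])⟩)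
    (fun e => hl ⟨1, Fin.ext (by simp [e])⟩), fun h l hl hl' => h l ?_⟩ rfl rfl
  rintro ⟨j, rfl⟩
  fin_cases j
  · exact hl rfl
  · exact hl' rfl

lemma opAt_of_le (R : Matrix (Fin N × Fin N) (Fin N × Fin N) α) {i : ℕ}
    (h : ¬ i + 1 < n) : opAt N n R i = 1 := dif_neg h

lemma siteEmbed_matAt {i : ℕ} (hi : i + m ≤ n) (X : Matrix (Fin N) (Fin N) α) {j : ℕ}
    (hj : j < m) :
    siteEmbed (fun l : Fin m => (⟨i + l, by omega⟩ : Fin n)) (matAt N m X j) =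
      matAt N n X (i + j) := by
  rw [matAt_eq_siteEmbed X hj, matAt_eq_siteEmbed X (by omega),
    siteEmbed_siteEmbed fun a b hab => Fin.ext (by simpa using hab)]
  rfl

lemma siteEmbed_opAt {i : ℕ} (hi : i + m ≤ n)
    (R : Matrix (Fin N × Fin N) (Fin N × Fin N) α) {j : ℕ} (hj : j + 1 < m) :
    siteEmbed (fun l : Fin m => (⟨i + l, by omega⟩ : Fin n)) (opAt N m R j) =
      opAt N n R (i + j) := by
  rw [opAt_eq_siteEmbed R hj, opAt_eq_siteEmbed R (by omega),
    siteEmbed_siteEmbed fun a b hab => Fin.ext (by simpa using hab)]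
  congr 1
  ext l
  simp [add_assoc]

lemma matAt_mul (X Y : Matrix (Fin N) (Fin N) α) (i : ℕ) :
    matAt N n (X * Y) i = matAt N n X i * matAt N n Y i := by
  by_cases h : i < n
  · simp only [matAt_eq_siteEmbed _ h]
    rw [← siteEmbed_mul fun _ _ _ => rfl, Matrix.submatrix_mul_equiv]
  · simp [matAt, h]

lemma opAt_mul (X Y : Matrix (Fin N × Fin N) (Fin N × Fin N) α) (i : ℕ) :
    opAt N n (X * Y) i = opAt N n X i * opAt N n Y i := by
  by_cases h : i + 1 < n
  · simp only [opAt_eq_siteEmbed _ h]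
    rw [← siteEmbed_mul fun a b hab => Fin.ext (by simpa using hab),
      Matrix.submatrix_mul_equiv]
  · simp [opAt, h]

lemma opAt_one (i : ℕ) :
    opAt N n (1 : Matrix (Fin N × Fin N) (Fin N × Fin N) α) i = 1 := by
  by_cases h : i + 1 < n
  · rw [opAt_eq_siteEmbed _ h, Matrix.submatrix_one_equiv, siteEmbed_one]
  · exact opAt_of_le _ h

lemma opAt_add (X Y : Matrix (Fin N × Fin N) (Fin N × Fin N) α) {i : ℕ} (h : i + 1 < n) :
    opAt N n (X + Y) i = opAt N n X i + opAt N n Y i := by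
  simp only [opAt_eq_siteEmbed _ h]
  rw [← siteEmbed_add]
  rfl

lemma opAt_smul {K : Type*} [CommSemiring K] [Algebra K α] (c : K)
    (X : Matrix (Fin N × Fin N) (Fin N × Fin N) α) {i : ℕ} (h : i + 1 < n) :
    opAt N n (c • X) i = c • opAt N n X i := by
  simp only [opAt_eq_siteEmbed _ h]
  rw [← siteEmbed_smul]
  rfl

lemma matAt_commute_opAt (X : Matrix (Fin N) (Fin N) α)
    (R : Matrix (Fin N × Fin N) (Fin N × Fin N) α)
    (hXR : ∀ a b c d, Commute (X a b) (R c d)) {i j : ℕ} (hij : i < j) :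
    Commute (matAt N n X i) (opAt N n R j) := by
  by_cases hj : j + 1 < n
  · rw [matAt_eq_siteEmbed X (show i < n by omega), opAt_eq_siteEmbed R hj]
    refine siteEmbed_commute (fun _ l => ?_) _ _ fun _ _ _ _ => hXR _ _ _ _
    simp only [ne_eq, Fin.mk.injEq]
    omega
  · rw [opAt_of_le R hj]
    exact Commute.one_right _

lemma opAt_commute_opAt (R S : Matrix (Fin N × Fin N) (Fin N × Fin N) α)
    (hRS : ∀ a b c d, Commute (R a b) (S c d)) {i j : ℕ} (hij : i + 2 ≤ j) :
    Commute (opAt N n R i) (opAt N n S j) := by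
  by_cases hj : j + 1 < n
  · rw [opAt_eq_siteEmbed R (show i + 1 < n by omega), opAt_eq_siteEmbed S hj]
    refine siteEmbed_commute (fun _ l => ?_) _ _ fun _ _ _ _ => hRS _ _ _ _
    simp only [ne_eq, Fin.mk.injEq]
    omega
  · rw [opAt_of_le S hj]
    exact Commute.one_right _

end sites

lemma RErel.extend {A : Type*} [Semiring A] {N n : ℕ}
    {R : Matrix (Fin N × Fin N) (Fin N × Fin N) A}
    {X : Matrix (Fin N) (Fin N) A}
    (h : RErel N R X) (hn : 2 ≤ n) :
    opAt N n R 0 * matAt N n X 0 * opAt N n R 0 * matAt N n X 0 =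
      matAt N n X 0 * opAt N n R 0 * matAt N n X 0 * opAt N n R 0 := by
  have hf : Function.Injective (fun l : Fin 2 => (⟨0 + l, by omega⟩ : Fin n)) :=
    fun a b hab => Fin.ext (by simpa using hab)
  have hA := congrArg (siteEmbed (fun l : Fin 2 => (⟨0 + l, by omega⟩ : Fin n))) h
  simp only [siteEmbed_mul hf, siteEmbed_opAt (show 0 + 2 ≤ n by omega) _ (show 0 + 1 < 2 by omega),
    siteEmbed_matAt (show 0 + 2 ≤ n by omega) _ (show 0 < 2 by omega), add_zero] at hA
  exact hA

section numeric

variable {A : Type*} [Ring A] [Algebra ℂ A] {N n : ℕ}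

lemma opAt_toA (R : Matrix (Fin N × Fin N) (Fin N × Fin N) ℂ) (i : ℕ) :
    opAt N n (toA A R) i = toA A (opAt N n R i) := by
  ext a b
  by_cases h : i + 1 < n
  · simp only [opAt, dif_pos h, toA, Matrix.map_apply, Matrix.of_apply]
    split_ifs <;> simp
  · by_cases hab : a = b <;> simp [opAt_of_le _ h, toA, hab]

lemma toA_mul {ι : Type*} [Fintype ι] (X Y : Matrix ι ι ℂ) :
    toA A (X * Y) = toA A X * toA A Y := Matrix.map_mul

lemma toA_one {ι : Type*} [Fintype ι] [DecidableEq ι] : toA A (1 : Matrix ι ι ℂ) = 1 := by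
  simp [toA]

lemma opAt_toA_mul_eq_one {R S : Matrix (Fin N × Fin N) (Fin N × Fin N) ℂ} (h : R * S = 1)
    (i : ℕ) : opAt N n (toA A R) i * opAt N n (toA A S) i = 1 := by
  rw [← opAt_mul, ← toA_mul, h, toA_one, opAt_one]

lemma IsBraid.opAt_toA {R : Matrix (Fin N × Fin N) (Fin N × Fin N) ℂ} (h : IsBraid N R)
    {i : ℕ} (hi : i + 2 < n) :
    opAt N n (toA A R) i * opAt N n (toA A R) (i + 1) * opAt N n (toA A R) i =
      opAt N n (toA A R) (i + 1) * opAt N n (toA A R) i * opAt N n (toA A R) (i + 1) := by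
  have hf : Function.Injective (fun l : Fin 3 => (⟨i + l, by omega⟩ : Fin n)) :=
    fun a b hab => Fin.ext (by simpa using hab)
  have hA := congrArg (fun X => siteEmbed (fun l : Fin 3 => (⟨i + l, by omega⟩ : Fin n))
    (toA A X)) h
  simp only [toA_mul, siteEmbed_mul hf, ← _root_.opAt_toA,
    siteEmbed_opAt (show i + 3 ≤ n by omega) _ (show 0 + 1 < 3 by omega),
    siteEmbed_opAt (show i + 3 ≤ n by omega) _ (show 1 + 1 < 3 by omega), add_zero] at hA
  exact hA

lemma PermRel.extend {R Rinv : Matrix (Fin N × Fin N) (Fin N × Fin N) ℂ}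
    {M D : Matrix (Fin N) (Fin N) A} (h : PermRel N R Rinv M D) (hn : 2 ≤ n) :
    matAt N n D 0 * opAt N n (toA A R) 0 * matAt N n M 0 * opAt N n (toA A R) 0 =
      opAt N n (toA A R) 0 * matAt N n M 0 * opAt N n (toA A Rinv) 0 * matAt N n D 0 +
        opAt N n (toA A R) 0 := by
  have hf : Function.Injective (fun l : Fin 2 => (⟨0 + l, by omega⟩ : Fin n)) :=
    fun a b hab => Fin.ext (by simpa using hab)
  have hA := congrArg (siteEmbed (fun l : Fin 2 => (⟨0 + l, by omega⟩ : Fin n))) h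
  simp only [siteEmbed_mul hf, siteEmbed_add,
    siteEmbed_opAt (show 0 + 2 ≤ n by omega) _ (show 0 + 1 < 2 by omega),
    siteEmbed_matAt (show 0 + 2 ≤ n by omega) _ (show 0 < 2 by omega), add_zero] at hA
  exact hA

end numeric

/-- For an invertible `R`, the Hecke condition says `R = R⁻¹ + (q - q⁻¹) I`. -/
lemma IsHecke.eq_add {N : ℕ} {q : ℂ} (hq : q ≠ 0)
    {R Rinv : Matrix (Fin N × Fin N) (Fin N × Fin N) ℂ} (h : IsHecke N q R)
    (hR : R * Rinv = 1) : R = Rinv + (q - q⁻¹) • 1 := by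
  have hmul := congrArg (· * Rinv) h
  simp only [sub_mul, mul_add, smul_mul_assoc, mul_smul_comm, one_mul, mul_one, add_mul,
    zero_mul, mul_assoc, hR, smul_sub, smul_smul] at hmul
  rw [inv_mul_cancel₀ hq, one_smul] at hmul
  rw [sub_smul, ← sub_eq_zero, ← neg_eq_zero, ← hmul]
  abel

/-- With `L̂ = MD`, for every `k ≥ 1` in `Mat_{N^{k+1}}(A)`:
`D_{⟨k→1⟩} L̂_{⟨k+1⟩} = L̂_{⟨k+1⟩} D_{⟨k→1⟩} J_{k+1}⁻¹ + D_{⟨k→1⟩} (I − J_{k+1}⁻¹)/(q − q⁻¹)`. -/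
theorem stmt15 {A : Type*} [Ring A] [Algebra ℂ A] (N : ℕ) (hN : 1 ≤ N) (q : ℂ)
    (hq : GenericQ q)
    (R Rinv : Matrix (Fin N × Fin N) (Fin N × Fin N) ℂ)
    (hRinv : R * Rinv = 1 ∧ Rinv * R = 1)
    (hbraid : IsBraid N R) (hHecke : IsHecke N q R)
    (M D : Matrix (Fin N) (Fin N) A)
    (hM : RErel N (toA A R) M)
    (hD : RErel N (toA A Rinv) D)
    (hDM : PermRel N R Rinv M D)
    (k : ℕ) (hk : 1 ≤ k) :
    ovProdRev N (k + 1) (toA A R) (toA A Rinv) D k *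
        ovCopy N (k + 1) (toA A R) (toA A Rinv) (M * D) k =
      ovCopy N (k + 1) (toA A R) (toA A Rinv) (M * D) k *
          ovProdRev N (k + 1) (toA A R) (toA A Rinv) D k *
          JMup N (k + 1) (toA A Rinv) 0 k +
        ovProdRev N (k + 1) (toA A R) (toA A Rinv) D k *
          ((q - q⁻¹)⁻¹ •
            ((1 : Matrix (Fin (k + 1) → Fin N) (Fin (k + 1) → Fin N) A) -
              JMup N (k + 1) (toA A Rinv) 0 k)) := by
  have hq0 := hq.1
  have hc : q - q⁻¹ ≠ 0 := fun h => hq.2.2.2 2 two_pos (by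
    rw [sub_eq_zero] at h
    nth_rewrite 1 [pow_two, h]
    exact inv_mul_cancel₀ hq0)
  set r := opAt N (k + 1) (toA A R) with hr
  set s := opAt N (k + 1) (toA A Rinv) with hs
  have hrs : ∀ i, r i * s i = 1 := opAt_toA_mul_eq_one hRinv.1
  have hsr : ∀ i, s i * r i = 1 := opAt_toA_mul_eq_one hRinv.2
  have hfar : ∀ i j, i + 2 ≤ j → Commute (r i) (r j) := fun i j hij =>
    opAt_commute_opAt _ _ (fun _ _ _ _ => Algebra.commutes _ _) hij
  have hX0 : ∀ (X : Matrix (Fin N) (Fin N) A) j, 1 ≤ j →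
      Commute (ovCopy N (k + 1) (toA A R) (toA A Rinv) X 0) (r j) := fun X j hj =>
    matAt_commute_opAt _ _ (fun _ _ _ _ => (Algebra.commutes _ _).symm) hj
  have hXr : ∀ (X : Matrix (Fin N) (Fin N) A) i j, i + 1 ≤ j →
      Commute (ovCopy N (k + 1) (toA A R) (toA A Rinv) X i) (r j) := fun X =>
    commute_conjCopy hrs hsr hfar (fun _ => rfl) (hX0 X)
  have hPr : ∀ i, ∀ j, i ≤ j →
      Commute (ovProdRev N (k + 1) (toA A R) (toA A Rinv) D i) (r j) := by
    intro i j hij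
    refine Commute.list_prod_left _ _ fun x hx => ?_
    simp only [List.mem_map, List.mem_reverse, List.mem_range] at hx
    obtain ⟨l, hl, rfl⟩ := hx
    exact hXr D l j (by omega)
  have hPs : ∀ i, Commute (ovProdRev N (k + 1) (toA A R) (toA A Rinv) D i) (s i) := fun i =>
    (Commute.units_inv_right (u := ⟨r i, s i, hrs i, hsr i⟩) (hPr i i le_rfl) :)
  have hhecke : ∀ i, i + 1 < k + 1 → r i - s i = (q - q⁻¹) • 1 := by
    intro i hi
    have hR : toA A R = toA A Rinv + (q - q⁻¹) • 1 := by
      conv_lhs => rw [hHecke.eq_add hq0 hRinv.1]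
      ext a b
      by_cases hab : a = b <;> simp [toA, hab, Algebra.algebraMap_eq_smul_one, add_smul, sub_smul]
    rw [sub_eq_iff_eq_add', hr, hR, opAt_add _ _ hi, opAt_smul _ _ hi, opAt_one]
  have hperm : ovCopy N (k + 1) (toA A R) (toA A Rinv) D 0 * r 0 *
        ovCopy N (k + 1) (toA A R) (toA A Rinv) (M * D) 0 =
      r 0 * ovCopy N (k + 1) (toA A R) (toA A Rinv) (M * D) 0 * s 0 *
        ovCopy N (k + 1) (toA A R) (toA A Rinv) D 0 * s 0 +
          ovCopy N (k + 1) (toA A R) (toA A Rinv) D 0 := by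
    have hDD := hD.extend (n := k + 1) (by omega)
    have hDMD := congrArg (· * s 0) (hDM.extend (n := k + 1) (by omega))
    simp only [ovCopy, matAt_mul]
    rw [← hr, ← hs] at hDMD
    rw [← hs] at hDD
    simp only [add_mul, mul_assoc, hrs, mul_one] at hDMD hDD ⊢
    rw [← hDD, ← mul_assoc (r 0), ← mul_assoc (matAt N (k + 1) D 0), hDMD]
    noncomm_ring
  exact conjCopy_prod_perm hc (n := k + 1) hrs hhecke (fun _ => rfl) rfl
    (fun i => by simp [ovProdRev, List.range_succ]) rfl
    (fun i => by simp [JMup, hs]) (fun i => hPr i i le_rfl) hPs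
    (conjCopy_perm hrs hsr (fun i hi => hbraid.opAt_toA hi) (fun _ => rfl) (fun _ => rfl)
      (fun i => hXr D i _ le_rfl) (fun i => hXr (M * D) i _ le_rfl) hperm) k (by omega)
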